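/- Let (X,d) be a compact metric space, f : X → X continuous with h_top(f) < +∞, and φ, ψ ∈ C(X,ℝ) with ψ > 0. If μ_∞ is a zero temperature limit of φ, i.e. there are equilibrium states μ_β of P_ψ(βφ) for all large β > 0 converging weak* to μ_∞ as β → ∞, then μ_∞ ∈ M_max^ψ(φ), i.e. (∫φ dμ_∞)/(∫ψ dμ_∞) = sup_{ν ∈ M(X,f)} (∫φ dν)/(∫ψ dν). -/

import Mathlib

open Filter Set Topology MeasureTheory ENNReal

variable {X : Type*}

/-- Birkhoff sum `S_n φ = ∑_{i<n} φ ∘ f^i`. -/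
def birkhoff (f : X → X) (φ : X → ℝ) (n : ℕ) (x : X) : ℝ :=
  ∑ i ∈ Finset.range n, φ (f^[i] x)

section Metric
variable [MetricSpace X]

/-- `F` is an `(n,ε)`-spanning set of `Z`: every `y ∈ Z` is within Bowen distance
`d_n ≤ ε` of some point of `F`. -/
def IsSpanningSetOf (f : X → X) (n : ℕ) (ε : ℝ) (Z : Set X) (F : Finset X) : Prop :=
  ∀ y ∈ Z, ∃ x ∈ F, ∀ i < n, dist (f^[i] x) (f^[i] y) ≤ ε

/-- `E` is an `(n,ε)`-separated set of `Z`: `E ⊆ Z` and distinct points of `E` are at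
Bowen distance `d_n > ε`. -/
def IsSeparatedSetOf (f : X → X) (n : ℕ) (ε : ℝ) (Z : Set X) (E : Finset X) : Prop :=
  (E : Set X) ⊆ Z ∧ ∀ x ∈ E, ∀ y ∈ E, x ≠ y → ∃ i < n, ε < dist (f^[i] x) (f^[i] y)

/-- `S_T = {n : ℕ | ∃ x, S_nψ(x) ≤ T < S_{n+1}ψ(x)}`. -/
def inducedST (f : X → X) (ψ : X → ℝ) (T : ℝ) : Set ℕ :=
  {n | ∃ x : X, birkhoff f ψ n x ≤ T ∧ T < birkhoff f ψ (n + 1) x}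

/-- `X_n = {x | S_nψ(x) ≤ T < S_{n+1}ψ(x)}`. -/
def inducedXn (f : X → X) (ψ : X → ℝ) (T : ℝ) (n : ℕ) : Set X :=
  {x | birkhoff f ψ n x ≤ T ∧ T < birkhoff f ψ (n + 1) x}

/-- `Q_{ψ,T}(f,φ,ε)`: infimum over families of `(n,ε)`-spanning sets of the `X_n`, `n ∈ S_T`,
of `∑_{n ∈ S_T} ∑_{x ∈ F_n} e^{S_nφ(x)}`. -/
noncomputable def inducedQ (f : X → X) (ψ φ : X → ℝ) (T ε : ℝ) : ℝ≥0∞ :=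
  ⨅ (F : ℕ → Finset X) (_ : ∀ n ∈ inducedST f ψ T,
      IsSpanningSetOf f n ε (inducedXn f ψ T n) (F n)),
    ∑' n : inducedST f ψ T, ∑ x ∈ F n, ENNReal.ofReal (Real.exp (birkhoff f φ n x))

/-- `P_{ψ,T}(f,φ,ε)`: supremum over families of `(n,ε)`-separated sets of the `X_n`, `n ∈ S_T`,
of `∑_{n ∈ S_T} ∑_{x ∈ E_n} e^{S_nφ(x)}`. -/
noncomputable def inducedPsep (f : X → X) (ψ φ : X → ℝ) (T ε : ℝ) : ℝ≥0∞ :=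
  ⨆ (E : ℕ → Finset X) (_ : ∀ n ∈ inducedST f ψ T,
      IsSeparatedSetOf f n ε (inducedXn f ψ T n) (E n)),
    ∑' n : inducedST f ψ T, ∑ x ∈ E n, ENNReal.ofReal (Real.exp (birkhoff f φ n x))

/-- The ψ-induced topological pressure
`P_ψ(φ) = lim_{ε→0⁺} limsup_{T→∞} (1/T) log Q_{ψ,T}(f,φ,ε)`, the limit as `ε → 0⁺`
being realized as a `limsup` along `𝓝[>] 0` (since `ε ↦ limsup_T …` is monotone,
this coincides with the limit). -/
noncomputable def inducedPressure (f : X → X) (ψ φ : X → ℝ) : EReal :=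
  limsup (fun ε : ℝ =>
    limsup (fun T : ℝ => ENNReal.log (inducedQ f ψ φ T ε) * ((T⁻¹ : ℝ) : EReal)) atTop)
    (𝓝[>] (0 : ℝ))

/-- Topological entropy `h_top(f) = P_ψ(0)` with `ψ ≡ 1`. -/
noncomputable def topEntropy (f : X → X) : EReal :=
  inducedPressure f (fun _ => 1) (fun _ => 0)

end Metric
section Meas
variable [MetricSpace X] [MeasurableSpace X] [BorelSpace X]

/-- Entropy of the finite measurable partition of `X` induced by a map `q` into a finite
type: `H(q) = ∑_s -μ(q⁻¹{s}) log μ(q⁻¹{s})`. -/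
noncomputable def mapEntropy {S : Type*} [Fintype S] (μ : Measure X) (q : X → S) : ℝ :=
  ∑ s : S, Real.negMulLog ((μ (q ⁻¹' {s})).toReal)

/-- Kolmogorov–Sinai (measure-theoretic) entropy `h_μ(f)`: the supremum, over finite
measurable partitions (encoded as measurable maps `p : X → Fin k`), of
`lim_n (1/n) H(⋁_{i<n} f^{-i} p)`; the limit exists by subadditivity and is
realized here as a `liminf`. -/
noncomputable def measEntropy (f : X → X) (μ : Measure X) : EReal :=
  ⨆ (k : ℕ) (p : X → Fin k) (_ : Measurable p),
    liminf (fun n : ℕ =>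
      (((n : ℝ)⁻¹ * mapEntropy μ (fun x (i : Fin n) => p (f^[i] x)) : ℝ) : EReal)) atTop

/-- The set `M(X,f)` of `f`-invariant Borel probability measures on `X`. -/
def invMeasures (f : X → X) : Set (Measure X) :=
  {μ | IsProbabilityMeasure μ ∧ ∀ B : Set X, MeasurableSet B → μ (f ⁻¹' B) = μ B}

/-- `μ` is an equilibrium state of `P_ψ(φ)`:
`μ ∈ M(X,f)` and `P_ψ(φ) = (h_μ(f) + ∫φ dμ)/(∫ψ dμ)`. -/
noncomputable def equilibriumStates (f : X → X) (ψ φ : X → ℝ) : Set (Measure X) :=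
  {μ | μ ∈ invMeasures f ∧
    inducedPressure f ψ φ =
      (measEntropy f μ + ((∫ x, φ x ∂μ : ℝ) : EReal)) / (((∫ x, ψ x ∂μ : ℝ) : EReal))}

end Meas

section Freeze
variable [MetricSpace X] [MeasurableSpace X] [BorelSpace X]

/-- `Max^ψ(φ) = sup_{μ ∈ M(X,f)} (∫φ dμ)/(∫ψ dμ)`. -/
noncomputable def maxRatio (f : X → X) (ψ φ : X → ℝ) : ℝ :=
  ⨆ ν : invMeasures f, (∫ x, φ x ∂(ν : Measure X)) / (∫ x, ψ x ∂(ν : Measure X))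

/-- `M_max^ψ(φ) = {μ ∈ M(X,f) : (∫φ dμ)/(∫ψ dμ) = Max^ψ(φ)}`. -/
def maxSet (f : X → X) (ψ φ : X → ℝ) : Set (Measure X) :=
  {μ ∈ invMeasures f |
    (∫ x, φ x ∂μ) / (∫ x, ψ x ∂μ) = maxRatio f ψ φ}

/-- `h_∞^ψ(φ) = sup{h_μ(f)/(∫ψ dμ) : μ ∈ M_max^ψ(φ)}`. -/
noncomputable def hInfty (f : X → X) (ψ φ : X → ℝ) : EReal :=
  ⨆ μ : maxSet f ψ φ, measEntropy f (μ : Measure X) / (((∫ x, ψ x ∂(μ : Measure X) : ℝ)) : EReal)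

end Freeze

section BirkhoffSums

lemma birkhoff_add (f : X → X) (u : X → ℝ) (m n : ℕ) (x : X) :
    birkhoff f u (m + n) x = birkhoff f u m x + birkhoff f u n (f^[m] x) :=
  birkhoffSum_add f u m n x

lemma birkhoff_le_mul {f : X → X} {u : X → ℝ} {b : ℝ} (hu : ∀ x, u x ≤ b) (n : ℕ) (x : X) :
    birkhoff f u n x ≤ n * b := by
  unfold birkhoff
  calc _ ≤ ∑ i ∈ Finset.range n, b := Finset.sum_le_sum fun i _ => hu _
    _ = n * b := by simp

lemma mul_le_birkhoff {f : X → X} {u : X → ℝ} {a : ℝ} (hu : ∀ x, a ≤ u x) (n : ℕ) (x : X) :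
    n * a ≤ birkhoff f u n x := by
  unfold birkhoff
  calc n * a = ∑ i ∈ Finset.range n, a := by simp
    _ ≤ _ := Finset.sum_le_sum fun i _ => hu _

/-- If every point admits a stopping time bounded by `L` at which the Birkhoff sum is below `-1`,
then the Birkhoff sums of `u` tend to `-∞` linearly. -/
lemma birkhoff_le_of_stopping {f : X → X} {u : X → ℝ} {B L : ℝ} (hB : ∀ x, u x ≤ B)
    (hB0 : 0 ≤ B) (hL : 0 < L) (τ : X → ℕ) (hτ : ∀ y, τ y ≤ L)
    (hu : ∀ y, birkhoff f u (τ y) y < -1) (N : ℕ) :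
    ∀ y, birkhoff f u N y ≤ -(N / L) + (L * B + 1) := by
  induction N using Nat.strong_induction_on with
  | _ N ih =>
    intro y
    rcases le_or_gt (τ y) N with h | h
    · have hpos : 0 < τ y := by
        rcases Nat.eq_zero_or_pos (τ y) with h0 | h0
        · have := hu y
          rw [h0] at this
          simp [birkhoff] at this
          linarith
        · exact h0
      obtain ⟨k, rfl⟩ := Nat.exists_eq_add_of_le h
      rw [birkhoff_add]
      have h1 := ih k (by omega) (f^[τ y] y)
      have h2 := hu y
      have h3 : (τ y : ℝ) / L ≤ 1 := (div_le_one hL).2 (hτ y)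
      push_cast
      rw [add_div]
      linarith
    · have hN : (N : ℝ) ≤ L := (Nat.cast_le.2 h.le).trans (hτ y)
      have h1 := birkhoff_le_mul (f := f) hB N y
      have h2 : (N : ℝ) / L ≤ 1 := (div_le_one hL).2 hN
      have h3 : (N : ℝ) * B ≤ L * B := by gcongr
      linarith

lemma exists_mem_inducedXn [MetricSpace X] {f : X → X} {ψ : X → ℝ} {m T : ℝ} (hm : 0 < m)
    (hψ : ∀ x, m ≤ ψ x) (hT : 0 ≤ T) (y : X) :
    ∃ n : ℕ, y ∈ inducedXn f ψ T n ∧ n ≤ T / m := by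
  classical
  have hex : ∃ k : ℕ, T < birkhoff f ψ k y := by
    obtain ⟨k, hk⟩ := exists_nat_gt (T / m)
    exact ⟨k, ((div_lt_iff₀ hm).1 hk).trans_le (mul_le_birkhoff hψ k y)⟩
  obtain ⟨n, hn⟩ : ∃ n, Nat.find hex = n + 1 := by
    refine Nat.exists_eq_succ_of_ne_zero fun h => ?_
    have := Nat.find_spec hex
    rw [h] at this
    simp [birkhoff] at this
    linarith
  have h1 : birkhoff f ψ n y ≤ T := not_lt.1 (Nat.find_min hex (by omega))
  refine ⟨n, ⟨h1, hn ▸ Nat.find_spec hex⟩, ?_⟩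
  rw [le_div_iff₀ hm]
  exact (mul_le_birkhoff hψ n y).trans h1

variable [MeasurableSpace X]

lemma integral_birkhoff {f : X → X} {ν : Measure X} (hf : MeasurePreserving f ν ν) {u : X → ℝ}
    (hu : Integrable u ν) (n : ℕ) : ∫ x, birkhoff f u n x ∂ν = n * ∫ x, u x ∂ν := by
  unfold birkhoff
  rw [integral_finsetSum (f := fun i x => u (f^[i] x)) _
    fun i _ => (hf.iterate i).integrable_comp_of_integrable hu]
  have : ∀ i, ∫ x, u (f^[i] x) ∂ν = ∫ x, u x ∂ν := fun i => by
    have h := hf.iterate i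
    conv_rhs => rw [← h.map_eq]
    rw [integral_map h.aemeasurable (by rw [h.map_eq]; exact hu.aestronglyMeasurable)]
  simp [this]

lemma integrable_birkhoff {f : X → X} {ν : Measure X} (hf : MeasurePreserving f ν ν) {u : X → ℝ}
    (hu : Integrable u ν) (n : ℕ) : Integrable (birkhoff f u n) ν :=
  integrable_finsetSum _ fun i _ => (hf.iterate i).integrable_comp_of_integrable hu

lemma exists_neg_one_le_birkhoff {f : X → X} {ν : Measure X} [IsProbabilityMeasure ν]
    (hf : MeasurePreserving f ν ν) {u : X → ℝ} (hu : Integrable u ν) (hint : ∫ x, u x ∂ν = 0)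
    {B L : ℝ} (hB : ∀ x, u x ≤ B) (hL : 0 < L) (τ : X → ℕ) (hτ : ∀ y, τ y ≤ L) :
    ∃ y, -1 ≤ birkhoff f u (τ y) y := by
  by_contra! h
  have key := birkhoff_le_of_stopping (B := max B 0) (fun x => (hB x).trans (le_max_left _ _))
    (le_max_right _ _) hL τ hτ h
  obtain ⟨N, hN⟩ := exists_nat_gt ((L * max B 0 + 1) * L)
  have h1 : ∫ x, birkhoff f u N x ∂ν ≤ ∫ _, (-(N / L) + (L * max B 0 + 1)) ∂ν :=
    integral_mono (integrable_birkhoff hf hu N) (integrable_const _) (key N)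
  rw [integral_birkhoff hf hu, hint] at h1
  simp only [integral_const, probReal_univ, one_smul, mul_zero] at h1
  have h2 := (lt_div_iff₀ hL).2 hN
  linarith

end BirkhoffSums

section Pressure
variable [MetricSpace X]

lemma le_inducedQ {f : X → X} {ψ φ : X → ℝ} {T ε η a : ℝ} {n : ℕ} {y : X}
    (hη : ∀ x y, dist x y ≤ ε → |φ x - φ y| ≤ η)
    (hy : y ∈ inducedXn f ψ T n) (ha : a ≤ birkhoff f φ n y - n * η) :
    ENNReal.ofReal (Real.exp a) ≤ inducedQ f ψ φ T ε := by
  refine le_iInf₂ fun F hF => ?_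
  have hn : n ∈ inducedST f ψ T := ⟨y, hy⟩
  obtain ⟨x, hx, hxy⟩ := hF n hn y hy
  have h1 : birkhoff f φ n y - birkhoff f φ n x ≤ n * η := by
    unfold birkhoff
    rw [← Finset.sum_sub_distrib]
    calc _ ≤ ∑ i ∈ Finset.range n, η := Finset.sum_le_sum fun i hi => by
          have := hη _ _ (hxy i (Finset.mem_range.1 hi))
          rw [abs_sub_comm] at this
          exact (le_abs_self _).trans this
      _ = n * η := by simp
  calc ENNReal.ofReal (Real.exp a) ≤ ENNReal.ofReal (Real.exp (birkhoff f φ n x)) :=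
        ENNReal.ofReal_le_ofReal (Real.exp_le_exp.2 (by linarith))
    _ ≤ ∑ x ∈ F n, ENNReal.ofReal (Real.exp (birkhoff f φ n x)) :=
        Finset.single_le_sum (f := fun x => ENNReal.ofReal (Real.exp (birkhoff f φ n x)))
          (fun _ _ => zero_le) hx
    _ ≤ _ := ENNReal.le_tsum
        (f := fun n : inducedST f ψ T => ∑ x ∈ F n, ENNReal.ofReal (Real.exp (birkhoff f φ n x)))
        ⟨n, hn⟩

lemma log_ofReal_exp (a : ℝ) : ENNReal.log (ENNReal.ofReal (Real.exp a)) = a := by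
  rw [ENNReal.log_ofReal_of_pos (Real.exp_pos a), Real.log_exp]

lemma coe_le_log_mul_inv {Q : ℝ≥0∞} {c T : ℝ} (hT : 0 < T)
    (hQ : ENNReal.ofReal (Real.exp (c * T)) ≤ Q) :
    (c : EReal) ≤ ENNReal.log Q * ((T⁻¹ : ℝ) : EReal) := by
  have h1 : ((c * T : ℝ) : EReal) ≤ ENNReal.log Q := by
    rw [← log_ofReal_exp]
    exact ENNReal.log_monotone hQ
  calc (c : EReal) = ((c * T : ℝ) : EReal) * ((T⁻¹ : ℝ) : EReal) := by
        rw [← EReal.coe_mul, mul_inv_cancel_right₀ hT.ne']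
    _ ≤ _ := mul_le_mul_of_nonneg_right h1 (by exact_mod_cast (inv_pos.2 hT).le)

lemma exists_isSpanningSetOf_of_topEntropy_lt [Nonempty X] {f : X → X} {C : ℝ}
    (h : topEntropy f < C) : ∀ᶠ ε in 𝓝[>] (0 : ℝ), ∀ᶠ n : ℕ in atTop,
      ∃ F : Finset X, IsSpanningSetOf f n ε univ F ∧ Real.log F.card ≤ C * n := by
  filter_upwards [eventually_lt_of_limsup_lt h] with ε hε
  filter_upwards [tendsto_natCast_atTop_atTop.eventually (eventually_lt_of_limsup_lt hε),
    eventually_gt_atTop 0] with n hn hn0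
  have hQ : inducedQ f (fun _ => 1) (fun _ => 0) n ε < ENNReal.ofReal (Real.exp (C * n)) := by
    by_contra! hle
    exact absurd (coe_le_log_mul_inv (by exact_mod_cast hn0) hle) (not_le.2 hn)
  simp only [inducedQ, iInf_lt_iff] at hQ
  obtain ⟨F, hF, hlt⟩ := hQ
  have hX : ∀ x : X, x ∈ inducedXn f (fun _ => 1) n n := fun x => by
    simp [inducedXn, birkhoff]
  have hmem : n ∈ inducedST f (fun _ => (1 : ℝ)) n := ⟨Classical.arbitrary X, hX _⟩
  have hspan : IsSpanningSetOf f n ε univ (F n) := fun y _ => hF n hmem y (hX y)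
  refine ⟨F n, hspan, ?_⟩
  have h1 := (ENNReal.le_tsum (f := fun n : inducedST f (fun _ => (1 : ℝ)) n =>
    ∑ x ∈ F n, ENNReal.ofReal (Real.exp (birkhoff f (fun _ => 0) n x))) ⟨n, hmem⟩).trans_lt hlt
  simp only [birkhoff, Finset.sum_const_zero, Real.exp_zero, ENNReal.ofReal_one,
    Finset.sum_const, nsmul_eq_mul, mul_one] at h1
  rw [← ENNReal.ofReal_natCast, ENNReal.ofReal_lt_ofReal_iff (Real.exp_pos _)] at h1
  obtain ⟨x, hx, _⟩ := hspan (Classical.arbitrary X) trivial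
  have hpos : 0 < ((F n).card : ℝ) := by exact_mod_cast Finset.card_pos.2 ⟨x, hx⟩
  exact ((Real.log_lt_iff_lt_exp hpos).2 h1).le

variable [MeasurableSpace X] [BorelSpace X]

/-- Entropy-free half of the variational inequality for the induced pressure. -/
lemma integral_div_le_inducedPressure [CompactSpace X] {f : X → X} {φ ψ : X → ℝ}
    (hφ : Continuous φ) (hψ : Continuous ψ) {m : ℝ} (hm : 0 < m) (hmψ : ∀ x, m ≤ ψ x)
    {ν : Measure X} [IsProbabilityMeasure ν] (hν : MeasurePreserving f ν ν) :
    (((∫ x, φ x ∂ν) / ∫ x, ψ x ∂ν : ℝ) : EReal) ≤ inducedPressure f ψ φ := by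
  set c : ℝ := (∫ x, φ x ∂ν) / ∫ x, ψ x ∂ν with hc
  have hφi : Integrable φ ν :=
    hφ.integrable_of_hasCompactSupport (HasCompactSupport.of_compactSpace φ)
  have hψi : Integrable ψ ν :=
    hψ.integrable_of_hasCompactSupport (HasCompactSupport.of_compactSpace ψ)
  have hψint : 0 < ∫ x, ψ x ∂ν := by
    have : ∫ _, m ∂ν ≤ ∫ x, ψ x ∂ν := integral_mono (integrable_const _) hψi hmψ
    simp at this
    linarith
  obtain ⟨M, hM⟩ := isCompact_univ.exists_bound_of_continuousOn hψ.continuousOn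
  have hu : Continuous fun x => φ x - c * ψ x := by fun_prop
  obtain ⟨B, hB⟩ := isCompact_univ.exists_bound_of_continuousOn hu.continuousOn
  have hui : Integrable (fun x => φ x - c * ψ x) ν := hφi.sub (hψi.const_mul c)
  have hint : ∫ x, (φ x - c * ψ x) ∂ν = 0 := by
    rw [integral_sub hφi (hψi.const_mul c), integral_const_mul, hc]
    field_simp
    ring
  have hpoint : ∀ T > 0, ∃ (n : ℕ) (y : X), y ∈ inducedXn f ψ T n ∧ n ≤ T / m ∧
      c * T - |c| * M - 1 ≤ birkhoff f φ n y := by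
    intro T hT
    choose τ hτ hτ' using fun y => exists_mem_inducedXn (f := f) hm hmψ hT.le y
    obtain ⟨y, hy⟩ := exists_neg_one_le_birkhoff hν hui hint (B := B)
      (fun x => (le_abs_self _).trans (hB x trivial)) (div_pos hT hm) τ hτ'
    refine ⟨τ y, y, hτ y, hτ' y, ?_⟩
    have hsplit : birkhoff f (fun x => φ x - c * ψ x) (τ y) y
        = birkhoff f φ (τ y) y - c * birkhoff f ψ (τ y) y := by
      simp [birkhoff, Finset.sum_sub_distrib, Finset.mul_sum]
    rw [hsplit] at hy
    have h1 := (hτ y).1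
    have h2 := (hτ y).2
    rw [birkhoff_add] at h2
    have h3 : birkhoff f ψ 1 (f^[τ y] y) ≤ M := by
      simpa [birkhoff] using (le_abs_self _).trans (hM (f^[τ y] y) trivial)
    have h4 : c * (T - birkhoff f ψ (τ y) y) ≤ |c| * M :=
      (mul_le_mul_of_nonneg_right (le_abs_self c) (by linarith)).trans
        (mul_le_mul_of_nonneg_left (by linarith) (abs_nonneg c))
    linarith
  refine EReal.ge_of_forall_gt_iff_ge.1 fun c' hc' => ?_
  rw [EReal.coe_lt_coe_iff] at hc'
  have hη : 0 < m * (c - c') / 2 := by have := sub_pos.2 hc'; positivity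
  obtain ⟨δ, hδ, hunif⟩ := Metric.uniformContinuous_iff.1
    (CompactSpace.uniformContinuous_of_continuous hφ) _ hη
  refine le_limsup_of_frequently_le (Eventually.frequently ?_)
  filter_upwards [nhdsWithin_le_nhds (Iio_mem_nhds hδ)] with ε hε
  refine le_limsup_of_frequently_le (Eventually.frequently ?_)
  filter_upwards [eventually_gt_atTop 0,
    eventually_ge_atTop ((|c| * M + 1) / ((c - c') / 2))] with T hT hTK
  refine coe_le_log_mul_inv hT ?_
  obtain ⟨n, y, hy, hn, hny⟩ := hpoint T hT
  refine le_inducedQ (η := m * (c - c') / 2)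
    (fun x y hxy => (hunif (hxy.trans_lt hε)).le) hy ?_
  rw [div_le_iff₀ (by linarith)] at hTK
  have h1 : (n : ℝ) * (m * (c - c') / 2) ≤ T * ((c - c') / 2) := by
    rw [le_div_iff₀ hm] at hn
    calc (n : ℝ) * (m * (c - c') / 2) = n * m * ((c - c') / 2) := by ring
      _ ≤ _ := mul_le_mul_of_nonneg_right hn (by linarith)
  nlinarith

end Pressure

section Entropy

lemma sum_negMulLog_le {S : Type*} [Fintype S] {p q : S → ℝ} (hp : ∀ s, 0 ≤ p s)
    (hp1 : ∑ s, p s = 1) (hq : ∀ s, 0 < q s) (hq1 : ∑ s, q s ≤ 1) :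
    ∑ s, Real.negMulLog (p s) ≤ ∑ s, p s * -Real.log (q s) := by
  have key : ∀ s, Real.negMulLog (p s) ≤ p s * -Real.log (q s) + (q s - p s) := by
    intro s
    rcases (hp s).eq_or_lt with h | h
    · simp [← h, (hq s).le]
    · have h1 := Real.log_le_sub_one_of_pos (div_pos (hq s) h)
      rw [Real.log_div (hq s).ne' h.ne'] at h1
      have h2 := mul_le_mul_of_nonneg_left h1 h.le
      have h3 : p s * (q s / p s - 1) = q s - p s := by field_simp
      rw [h3] at h2
      rw [Real.negMulLog]
      linarith
  calc _ ≤ ∑ s, (p s * -Real.log (q s) + (q s - p s)) := Finset.sum_le_sum fun s _ => key s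
    _ ≤ _ := by
      rw [Finset.sum_add_distrib, Finset.sum_sub_distrib]
      linarith

variable [MeasurableSpace X]

lemma mapEntropy_le_integral {S : Type*} [Fintype S] [MeasurableSpace S]
    [MeasurableSingletonClass S] {μ : Measure X} [IsProbabilityMeasure μ] {g : X → S}
    (hg : Measurable g) {q : S → ℝ} (hq : ∀ s, 0 < q s) (hq1 : ∑ s, q s ≤ 1) :
    mapEntropy μ g ≤ ∫ x, -Real.log (q (g x)) ∂μ := by
  have : IsProbabilityMeasure (μ.map g) := Measure.isProbabilityMeasure_map hg.aemeasurable
  have hmap : ∀ s, (μ (g ⁻¹' {s})).toReal = (μ.map g).real {s} := fun s => by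
    rw [Measure.real, Measure.map_apply hg (measurableSet_singleton s)]
  have h1 : ∫ x, -Real.log (q (g x)) ∂μ = ∑ s, (μ.map g).real {s} * -Real.log (q s) := by
    rw [← integral_map (f := fun s => -Real.log (q s)) hg.aemeasurable
      (Measurable.of_discrete).aestronglyMeasurable, integral_fintype (by simp)]
    simp
  rw [h1]
  simp only [mapEntropy, hmap]
  refine sum_negMulLog_le (fun s => measureReal_nonneg) ?_ hq hq1
  rw [sum_measureReal_singleton]
  simp

/-- A finite code `c` which predicts the symbol `p` of every point of `G` from any `ε`-close point
bounds the entropy of the `n`-th refinement of `p` by the size of a spanning set. -/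
lemma mapEntropy_le_of_isSpanningSetOf [MetricSpace X] [Nonempty X] {f : X → X} {μ : Measure X}
    [IsProbabilityMeasure μ] (hf : MeasurePreserving f μ μ) {k : ℕ} {p : X → Fin k}
    (hp : Measurable p) {G : Set X} (hG : MeasurableSet G) {ε : ℝ} {c : X → Fin k}
    (hc : ∀ x, ∀ y ∈ G, dist x y ≤ ε → c x = p y) {n : ℕ} {F : Finset X}
    (hF : IsSpanningSetOf f n ε univ F) :
    mapEntropy μ (fun x (i : Fin n) => p (f^[i] x)) ≤
      Real.log F.card + n * (Real.log 2 + Real.log k * μ.real Gᶜ) := by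
  classical
  obtain ⟨x₀⟩ := ‹Nonempty X›
  have hk : 0 < (k : ℝ) := by exact_mod_cast (p x₀).pos
  have hk1 : 1 ≤ (k : ℝ) := by exact_mod_cast (p x₀).pos
  have hFne : F.Nonempty := let ⟨x, hx, _⟩ := hF x₀ trivial; ⟨x, hx⟩
  have hFc : 0 < (F.card : ℝ) := by exact_mod_cast hFne.card_pos
  set r : Fin k → Fin k → ℝ := fun a b => (if a = b then 2⁻¹ else 0) + (2 * (k : ℝ))⁻¹ with hr
  have hrpos : ∀ a b, 0 < r a b := fun a b => by
    simp only [hr]; split_ifs <;> positivity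
  have hrsum : ∀ b, ∑ a, r a b = 1 := fun b => by
    simp only [hr, Finset.sum_add_distrib, Finset.sum_ite_eq', Finset.mem_univ, if_true]
    simp
    field_simp
    norm_num
  set q : (Fin n → Fin k) → ℝ :=
    fun w => (F.card : ℝ)⁻¹ * ∑ x ∈ F, ∏ i, r (w i) (c (f^[i] x)) with hqdef
  have hprod : ∀ (w : Fin n → Fin k) x, 0 < ∏ i, r (w i) (c (f^[i] x)) :=
    fun w x => Finset.prod_pos fun i _ => hrpos _ _
  have hq : ∀ w, 0 < q w := fun w =>
    mul_pos (inv_pos.2 hFc) (Finset.sum_pos (fun x _ => hprod w x) hFne)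
  have hq1 : ∑ w, q w ≤ 1 := by
    simp only [hqdef]
    rw [← Finset.mul_sum, Finset.sum_comm]
    have : ∀ x, ∑ w : Fin n → Fin k, ∏ i, r (w i) (c (f^[i] x)) = 1 := fun x => by
      rw [← Fintype.prod_sum (fun (i : Fin n) a => r a (c (f^[i] x)))]
      simp [hrsum]
    simp only [this]
    simp [hFc.ne']
  have hname : Measurable fun x (i : Fin n) => p (f^[i] x) :=
    measurable_pi_lambda _ fun i => hp.comp (hf.iterate i).measurable
  refine (mapEntropy_le_integral hname hq hq1).trans ?_
  have hind : Integrable (Gᶜ.indicator fun _ => Real.log k) μ :=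
    (integrable_const _).indicator hG.compl
  have hpt : ∀ y, -Real.log (q fun i => p (f^[i] y)) ≤
      (Real.log F.card + n * Real.log 2) + birkhoff f (Gᶜ.indicator fun _ => Real.log k) n y := by
    intro y
    obtain ⟨x, hx, hxy⟩ := hF y trivial
    have h1 : (F.card : ℝ)⁻¹ * ∏ i : Fin n, r (p (f^[i] y)) (c (f^[i] x)) ≤
        q fun i => p (f^[i] y) := by
      refine mul_le_mul_of_nonneg_left ?_ (inv_pos.2 hFc).le
      exact Finset.single_le_sum
        (f := fun x => ∏ i : Fin n, r (p (f^[i] y)) (c (f^[i] x)))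
        (fun x _ => (hprod (fun i => p (f^[i] y)) x).le) hx
    have h2 := Real.log_le_log (mul_pos (inv_pos.2 hFc) (hprod (fun i => p (f^[i] y)) x)) h1
    rw [Real.log_mul (inv_pos.2 hFc).ne' (hprod (fun i => p (f^[i] y)) x).ne', Real.log_inv,
      Real.log_prod (fun i _ => (hrpos _ _).ne')] at h2
    have h3 : ∀ i : Fin n, -Real.log (r (p (f^[i] y)) (c (f^[i] x))) ≤
        Real.log 2 + Gᶜ.indicator (fun _ => Real.log k) (f^[i] y) := by
      intro i
      rw [← Real.log_inv]
      by_cases hi : f^[i] y ∈ G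
      · rw [indicator_of_notMem (by simpa using hi), add_zero]
        refine Real.log_le_log (inv_pos.2 (hrpos _ _)) ?_
        rw [hc _ _ hi (hxy i i.2)]
        refine inv_le_of_inv_le₀ two_pos ?_
        simp only [hr, if_true]
        have : 0 < (2 * (k : ℝ))⁻¹ := by positivity
        linarith
      · rw [indicator_of_mem (by simpa using hi), ← Real.log_mul two_ne_zero hk.ne']
        refine Real.log_le_log (inv_pos.2 (hrpos _ _)) ?_
        refine inv_le_of_inv_le₀ (by positivity) ?_
        simp only [hr]
        split_ifs <;> linarith
    have h4 := Finset.sum_le_sum fun i (_ : i ∈ (Finset.univ : Finset (Fin n))) => h3 i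
    rw [Finset.sum_neg_distrib, Finset.sum_add_distrib,
      Fin.sum_univ_eq_sum_range
        (fun i => Gᶜ.indicator (fun _ => Real.log k) (f^[i] y)) n] at h4
    simp only [Finset.sum_const, Finset.card_univ, Fintype.card_fin, nsmul_eq_mul] at h4
    unfold birkhoff
    linarith
  have hbi := integrable_birkhoff hf hind n
  have hqi : Integrable (fun y => -Real.log (q fun i => p (f^[i] y))) μ :=
    Integrable.comp_measurable (g := fun w => -Real.log (q w)) (by simp) hname
  calc _ ≤ ∫ y, ((Real.log F.card + n * Real.log 2) +
        birkhoff f (Gᶜ.indicator fun _ => Real.log k) n y) ∂μ :=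
        integral_mono hqi ((integrable_const _).add hbi) hpt
    _ = _ := by
      rw [integral_add (integrable_const _) hbi, integral_birkhoff hf hind,
        integral_indicator_const _ hG.compl]
      simp
      ring

variable [MetricSpace X] [BorelSpace X]

lemma exists_code [CompactSpace X] (μ : Measure X) [IsFiniteMeasure μ] {k : ℕ} (hk : 0 < k)
    {p : X → Fin k} (hp : Measurable p) {δ : ℝ} (hδ : 0 < δ) :
    ∃ G : Set X, MeasurableSet G ∧ μ.real Gᶜ ≤ δ ∧
      ∀ᶠ ε in 𝓝[>] (0 : ℝ), ∃ c : X → Fin k, ∀ x, ∀ y ∈ G, dist x y ≤ ε → c x = p y := by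
  have hδk : ENNReal.ofReal (δ / k) ≠ 0 := by
    have : 0 < (k : ℝ) := by exact_mod_cast hk
    simpa using div_pos hδ this
  choose K hKp hK hKμ using fun j : Fin k =>
    (hp (measurableSet_singleton j)).exists_isClosed_sdiff_lt (measure_ne_top μ _) hδk
  refine ⟨⋃ j, K j, MeasurableSet.iUnion fun j => (hK j).measurableSet, ?_, ?_⟩
  · have hsub : (⋃ j, K j)ᶜ ⊆ ⋃ j, (p ⁻¹' {j} \ K j) := fun x hx =>
      mem_iUnion.2 ⟨p x, rfl, fun h => hx (mem_iUnion.2 ⟨_, h⟩)⟩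
    have h1 : μ (⋃ j, K j)ᶜ ≤ ENNReal.ofReal δ := by
      calc _ ≤ ∑ j, μ (p ⁻¹' {j} \ K j) := (measure_mono hsub).trans (measure_iUnion_fintype_le _ _)
        _ ≤ ∑ _j : Fin k, ENNReal.ofReal (δ / k) := Finset.sum_le_sum fun j _ => (hKμ j).le
        _ = ENNReal.ofReal δ := by
          have : (k : ℝ) ≠ 0 := by exact_mod_cast hk.ne'
          rw [Finset.sum_const, Finset.card_univ, Fintype.card_fin, nsmul_eq_mul,
            ← ENNReal.ofReal_natCast, ← ENNReal.ofReal_mul (by positivity)]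
          congr 1
          field_simp
    exact ENNReal.toReal_le_of_le_ofReal hδ.le h1
  · have hdisj : ∀ i j : Fin k, ∀ᶠ ε in 𝓝[>] (0 : ℝ), i ≠ j →
        Disjoint (Metric.cthickening ε (K i)) (Metric.cthickening ε (K j)) := by
      intro i j
      by_cases hij : i = j
      · simp [hij]
      · have hd : Disjoint (K i) (K j) := by
          refine Set.disjoint_left.2 fun x hi hj => hij ?_
          rw [← (hKp i hi : p x = i), ← (hKp j hj : p x = j)]
        obtain ⟨η, hη, h⟩ := hd.exists_cthickenings (hK i).isCompact (hK j)
        filter_upwards [nhdsWithin_le_nhds (Iio_mem_nhds hη)] with ε hε _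
        exact h.mono (Metric.cthickening_mono (le_of_lt hε) _)
          (Metric.cthickening_mono (le_of_lt hε) _)
    filter_upwards [eventually_all.2 fun i => eventually_all.2 (hdisj i)] with ε hε
    have hex : ∀ x, ∃ j : Fin k, ∀ i, x ∈ Metric.cthickening ε (K i) → j = i := by
      intro x
      by_cases h : ∃ j, x ∈ Metric.cthickening ε (K j)
      · obtain ⟨j, hj⟩ := h
        refine ⟨j, fun i hi => ?_⟩
        by_contra hne
        exact Set.disjoint_left.1 (hε j i hne) hj hi
      · exact ⟨⟨0, hk⟩, fun i hi => (h ⟨i, hi⟩).elim⟩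
    choose c hc using hex
    refine ⟨c, fun x y hy hxy => hc x _ ?_⟩
    obtain ⟨j, hj⟩ := mem_iUnion.1 hy
    rw [hKp j hj]
    exact Metric.mem_cthickening_of_dist_le x y ε _ hj hxy

lemma measEntropy_le_of_topEntropy_lt [CompactSpace X] [Nonempty X] {f : X → X} {μ : Measure X}
    [IsProbabilityMeasure μ] (hf : MeasurePreserving f μ μ) {C : ℝ} (h : topEntropy f < C) :
    measEntropy f μ ≤ ((C + Real.log 2 + 1 : ℝ) : EReal) := by
  refine iSup₂_le fun k p => iSup_le fun hp => ?_
  have hk : 0 < k := (p (Classical.arbitrary X)).pos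
  have hlog : 0 ≤ Real.log k := Real.log_natCast_nonneg k
  obtain ⟨G, hG, hGμ, hc⟩ := exists_code μ hk hp (δ := (1 + Real.log k)⁻¹) (by positivity)
  obtain ⟨ε, ⟨c, hc⟩, hε⟩ := (hc.and (exists_isSpanningSetOf_of_topEntropy_lt h)).exists
  refine liminf_le_of_frequently_le (Eventually.frequently ?_)
  filter_upwards [hε, eventually_gt_atTop 0] with n ⟨F, hF, hFC⟩ hn
  rw [EReal.coe_le_coe_iff]
  have hn' : 0 < (n : ℝ) := by exact_mod_cast hn
  rw [inv_mul_le_iff₀ hn']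
  have h1 := mapEntropy_le_of_isSpanningSetOf hf hp hG hc hF
  have h2 : Real.log k * μ.real Gᶜ ≤ 1 := by
    calc _ ≤ Real.log k * (1 + Real.log k)⁻¹ := by gcongr
      _ ≤ 1 := by
        rw [← div_eq_mul_inv, div_le_one (by linarith)]
        linarith
  have h3 : (n : ℝ) * (Real.log 2 + Real.log k * μ.real Gᶜ) ≤ n * (Real.log 2 + 1) := by
    gcongr
  linarith

end Entropy

lemma measurePreserving_of_mem_invMeasures [MetricSpace X] [MeasurableSpace X] [BorelSpace X]
    {f : X → X} (hf : Continuous f) {μ : Measure X} (hμ : μ ∈ invMeasures f) :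
    MeasurePreserving f μ μ :=
  ⟨hf.measurable, Measure.ext fun B hB => by rw [Measure.map_apply hf.measurable hB, hμ.2 B hB]⟩

/-- If `μ_∞` is a zero temperature limit of `φ` (equilibrium states
`μ_β` of `P_ψ(βφ)` exist for all large `β` and converge weak* to `μ_∞` as `β → ∞`),
then `μ_∞ ∈ M_max^ψ(φ)`, i.e. `μ_∞` is invariant and
`(∫φ dμ_∞)/(∫ψ dμ_∞) = sup_{ν ∈ M(X,f)} (∫φ dν)/(∫ψ dν)`. -/
theorem zero_temperature_limit_maximizing
    {X : Type*} [MetricSpace X] [CompactSpace X] [Nonempty X]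
    [MeasurableSpace X] [BorelSpace X]
    (f : X → X) (hf : Continuous f)
    (φ ψ : X → ℝ) (hφ : Continuous φ) (hψ : Continuous ψ) (hψpos : ∀ x, 0 < ψ x)
    (htop : topEntropy f < ⊤)
    (μβ : ℝ → ProbabilityMeasure X) (μlim : ProbabilityMeasure X)
    (heq : ∀ᶠ β in atTop, (μβ β : Measure X) ∈ equilibriumStates f ψ (fun x => β * φ x))
    (hlim : Tendsto μβ atTop (𝓝 μlim)) :
    (μlim : Measure X) ∈ maxSet f ψ φ := by
  obtain ⟨C₀, hC₀, -⟩ := EReal.lt_iff_exists_real_btwn.1 htop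
  set C := C₀ + Real.log 2 + 1 with hC
  obtain ⟨x₀, -, hx₀⟩ := isCompact_univ.exists_isMinOn univ_nonempty hψ.continuousOn
  set m := ψ x₀ with hm
  have hmpos : 0 < m := hψpos x₀
  have hmψ : ∀ x, m ≤ ψ x := fun x => hx₀ (mem_univ x)
  have hinv : (μlim : Measure X) ∈ invMeasures f := by
    refine ⟨inferInstance, fun B hB => ?_⟩
    have h1 := ((ProbabilityMeasure.continuous_map hf).tendsto μlim).comp hlim
    have h2 : Tendsto μβ atTop (𝓝 (μlim.map hf.measurable.aemeasurable)) := by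
      refine h1.congr' ?_
      filter_upwards [heq] with β hβ
      exact Subtype.ext (measurePreserving_of_mem_invMeasures hf hβ.1).map_eq
    have h3 := congrArg (fun ν : ProbabilityMeasure X => (ν : Measure X) B)
      (tendsto_nhds_unique h2 hlim)
    simpa [Measure.map_apply hf.measurable hB] using h3
  have hconv : ∀ g : X → ℝ, Continuous g →
      Tendsto (fun β => ∫ x, g x ∂(μβ β : Measure X)) atTop (𝓝 (∫ x, g x ∂(μlim : Measure X))) :=
    fun g hg => ProbabilityMeasure.tendsto_iff_forall_integral_tendsto.1 hlim
      (BoundedContinuousFunction.mkOfCompact ⟨g, hg⟩)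
  have hψlow : ∀ ν : Measure X, IsProbabilityMeasure ν → m ≤ ∫ x, ψ x ∂ν := fun ν _ => by
    have : ∫ _, m ∂ν ≤ ∫ x, ψ x ∂ν := integral_mono (integrable_const _)
      (hψ.integrable_of_hasCompactSupport (HasCompactSupport.of_compactSpace ψ)) hmψ
    simpa using this
  have hle : ∀ ν ∈ invMeasures f, (∫ x, φ x ∂ν) / (∫ x, ψ x ∂ν) ≤
      (∫ x, φ x ∂(μlim : Measure X)) / (∫ x, ψ x ∂(μlim : Measure X)) := by
    intro ν hν
    have := hν.1
    have hlim2 : Tendsto (fun β : ℝ => (β⁻¹ * C + ∫ x, φ x ∂(μβ β : Measure X)) /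
        ∫ x, ψ x ∂(μβ β : Measure X)) atTop
        (𝓝 ((0 * C + ∫ x, φ x ∂(μlim : Measure X)) / ∫ x, ψ x ∂(μlim : Measure X))) :=
      ((tendsto_inv_atTop_zero.mul_const C).add (hconv φ hφ)).div (hconv ψ hψ)
        (hmpos.trans_le (hψlow _ inferInstance)).ne'
    rw [zero_mul, zero_add] at hlim2
    refine ge_of_tendsto hlim2 ?_
    filter_upwards [heq, eventually_gt_atTop 0] with β hβ hβ0
    have hb : 0 < ∫ x, ψ x ∂(μβ β : Measure X) := hmpos.trans_le (hψlow _ inferInstance)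
    have h1 := integral_div_le_inducedPressure (φ := fun x => β * φ x) (by fun_prop) hψ hmpos hmψ
      (measurePreserving_of_mem_invMeasures hf hν)
    rw [hβ.2] at h1
    have h2 := measEntropy_le_of_topEntropy_lt
      (measurePreserving_of_mem_invMeasures hf hβ.1) hC₀
    have h3 := h1.trans (EReal.div_le_div_right_of_nonneg (by exact_mod_cast hb.le)
      (add_le_add_left h2 _))
    rw [← EReal.coe_add, ← EReal.coe_div, EReal.coe_le_coe_iff, integral_const_mul,
      integral_const_mul, mul_div_assoc, ← hC] at h3
    have h4 : (C + β * ∫ x, φ x ∂(μβ β : Measure X)) / ∫ x, ψ x ∂(μβ β : Measure X) =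
        β * ((β⁻¹ * C + ∫ x, φ x ∂(μβ β : Measure X)) / ∫ x, ψ x ∂(μβ β : Measure X)) := by
      field_simp
    rw [h4] at h3
    exact le_of_mul_le_mul_left h3 hβ0
  refine ⟨hinv, le_antisymm ?_ ?_⟩
  · exact le_ciSup (f := fun ν : invMeasures f =>
      (∫ x, φ x ∂(ν : Measure X)) / (∫ x, ψ x ∂(ν : Measure X)))
      ⟨_, forall_mem_range.2 fun ν => hle ν ν.2⟩ ⟨_, hinv⟩
  · have : Nonempty (invMeasures f) := ⟨⟨_, hinv⟩⟩
    exact ciSup_le fun ν => hle ν ν.2
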